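/- arXiv:2202.10040 — 5 statements merged into one kernel-verified Lean document; each statement's English description precedes it below -/
import Mathlib

section
/- Let X be a topological space, ι an index set, h : X → ι → ℝ, and E : X → ℝ. Suppose x* is a local minimizer of E on the inequality-feasible set {x | ∀ i, 0 ≤ h x i}, and let θ* : ι → ℝ be any function with h x* i = (θ* i)^2 for all i. Then (x*, θ*) is a local minimizer of (x, θ) ↦ E x on the slack-feasible set {(x, θ) | ∀ i, h x i = (θ i)^2}, where X × (ι → ℝ) carries the product topology (with ι → ℝ given the product topology). -/
/-- A local minimizer of `E` on the inequality-feasible set, together with any slack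
variable `θ*` with `h x* i = (θ* i)^2`, gives a local minimizer of `(x, θ) ↦ E x`
on the slack-feasible set (product topology). -/
theorem local_min_ineq_to_slack {X : Type*} [TopologicalSpace X] {ι : Type*}
    (h : X → ι → ℝ) (E : X → ℝ) (xs : X) (θs : ι → ℝ)
    (hmem : xs ∈ {x : X | ∀ i, 0 ≤ h x i})
    (hloc : ∃ U ∈ nhds xs, ∀ x ∈ {x : X | ∀ i, 0 ≤ h x i} ∩ U, E xs ≤ E x)
    (hθ : ∀ i, h xs i = (θs i) ^ 2) :
    (xs, θs) ∈ {p : X × (ι → ℝ) | ∀ i, h p.1 i = (p.2 i) ^ 2} ∧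
      ∃ V ∈ nhds (xs, θs),
        ∀ p ∈ {p : X × (ι → ℝ) | ∀ i, h p.1 i = (p.2 i) ^ 2} ∩ V, E xs ≤ E p.1 := by
  obtain ⟨U, hU, hmin⟩ := hloc
  refine ⟨hθ, Prod.fst ⁻¹' U, continuous_fst.continuousAt.preimage_mem_nhds hU, ?_⟩
  rintro p ⟨hp, hpU⟩
  exact hmin p.1 ⟨fun i => (hp i).symm ▸ sq_nonneg (p.2 i), hpU⟩
end

section
/- Let X be a topological space, ι a finite index set, h : X → ι → ℝ such that x ↦ h x i is continuous for each i, and E : X → ℝ. Suppose (x*, θ*) ∈ X × (ι → ℝ) is a local minimizer of (x, θ) ↦ E x on the slack-feasible set {(x, θ) | ∀ i, h x i = (θ i)^2} (product topology on X × (ι → ℝ)). Then x* is a local minimizer of E on the inequality-feasible set {x | ∀ i, 0 ≤ h x i}. -/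
/-- For a finite index set and continuous constraints, a local minimizer of
`(x, θ) ↦ E x` on the slack-feasible set gives a local minimizer of `E` on the
inequality-feasible set. -/
theorem local_min_slack_to_ineq {X : Type*} [TopologicalSpace X] {ι : Type*} [Fintype ι]
    (h : X → ι → ℝ) (hcont : ∀ i, Continuous fun x => h x i) (E : X → ℝ)
    (xs : X) (θs : ι → ℝ)
    (hmem : (xs, θs) ∈ {p : X × (ι → ℝ) | ∀ i, h p.1 i = (p.2 i) ^ 2})
    (hloc : ∃ V ∈ nhds (xs, θs),
      ∀ p ∈ {p : X × (ι → ℝ) | ∀ i, h p.1 i = (p.2 i) ^ 2} ∩ V, E xs ≤ E p.1) :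
    xs ∈ {x : X | ∀ i, 0 ≤ h x i} ∧
      ∃ U ∈ nhds xs, ∀ x ∈ {x : X | ∀ i, 0 ≤ h x i} ∩ U, E xs ≤ E x := by
  refine ⟨fun i => (hmem i).symm ▸ sq_nonneg (θs i), ?_⟩
  obtain ⟨V, hV, hmin⟩ := hloc
  let φ : X → X × (ι → ℝ) :=
    fun x => (x, fun i => (if 0 ≤ θs i then 1 else -1) * √(h x i))
  have hφ : Continuous φ := by fun_prop
  have hφs : φ xs = (xs, θs) := by
    refine Prod.ext rfl (funext fun i => ?_)
    have hi : h xs i = θs i ^ 2 := hmem i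
    simp only [φ, hi, Real.sqrt_sq_eq_abs]
    split_ifs with hθ
    · rw [one_mul, abs_of_nonneg hθ]
    · rw [abs_of_neg (not_le.mp hθ), neg_one_mul, neg_neg]
  refine ⟨φ ⁻¹' V, hφ.continuousAt.preimage_mem_nhds (hφs ▸ hV), ?_⟩
  rintro x ⟨hx, hxV⟩
  refine hmin (φ x) ⟨fun i => ?_, hxV⟩
  simp only [φ, mul_pow, Real.sq_sqrt (hx i)]
  split_ifs <;> ring
end

section
/- Let n m : ℕ, f : (Fin n → ℝ) → ℝ, h : (Fin n → ℝ) → Fin m → ℝ, and fix Λ ∈ Fin m → ℝ. Define L : (Fin n → ℝ) × (Fin m → ℝ) → ℝ by L (x, θ) = f x − ∑ i, Λ i * (h x i − (θ i)^2). If (x*, θ*) is a local minimizer of L on all of (Fin n → ℝ) × (Fin m → ℝ), then 0 ≤ Λ i for all i. -/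
/-- A quadratic monomial with a local minimum anywhere has nonnegative leading coefficient. -/
theorem nonneg_of_isLocalMin_mul_sq {c a : ℝ} (hmin : IsLocalMin (fun t : ℝ => c * t ^ 2) a) :
    0 ≤ c := by
  obtain ⟨ε, hε, hball⟩ := Metric.eventually_nhds_iff.mp hmin
  have hadd : c * a ^ 2 ≤ c * (a + ε / 2) ^ 2 :=
    hball (by rw [Real.dist_eq, add_sub_cancel_left, abs_of_pos] <;> linarith)
  have hsub : c * a ^ 2 ≤ c * (a - ε / 2) ^ 2 :=
    hball (by rw [Real.dist_eq, sub_sub_cancel_left, abs_neg, abs_of_pos] <;> linarith)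
  exact nonneg_of_mul_nonneg_left (by linarith : 0 ≤ c * ε ^ 2) (by positivity)

theorem sum_mul_sub_sq_update {ι : Type*} [Fintype ι] [DecidableEq ι] (Λ b θ : ι → ℝ) (i : ι)
    (t : ℝ) :
    ∑ j, Λ j * (b j - (Function.update θ i t j) ^ 2) =
      ∑ j, Λ j * (b j - θ j ^ 2) - (Λ i * t ^ 2 - Λ i * θ i ^ 2) := by
  rw [← Finset.add_sum_erase _ _ (Finset.mem_univ i),
    ← Finset.add_sum_erase _ (fun j => Λ j * (b j - θ j ^ 2)) (Finset.mem_univ i),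
    Finset.sum_congr rfl fun j hj => by
      rw [Function.update_of_ne (Finset.ne_of_mem_erase hj)]]
  rw [Function.update_self]
  ring

open Finset in
/-- If `(x*, θ*)` is an unconstrained local minimizer of the slack-variable
Lagrangian `L (x, θ) = f x - ∑ i, Λ i * (h x i - (θ i)^2)`, then the multiplier
`Λ` is pointwise nonnegative (dual feasibility). -/
theorem dual_feasibility_of_local_min {n m : ℕ} (f : (Fin n → ℝ) → ℝ)
    (h : (Fin n → ℝ) → Fin m → ℝ) (Λ : Fin m → ℝ) (xs : Fin n → ℝ) (θs : Fin m → ℝ)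
    (hmin : IsLocalMin
      (fun p : (Fin n → ℝ) × (Fin m → ℝ) =>
        f p.1 - ∑ i : Fin m, Λ i * (h p.1 i - (p.2 i) ^ 2)) (xs, θs)) :
    ∀ i, 0 ≤ Λ i := by
  intro i
  have hcont : ContinuousAt (fun t : ℝ => (xs, Function.update θs i t)) (θs i) := by fun_prop
  rw [← Function.update_eq_self i θs] at hmin
  refine nonneg_of_isLocalMin_mul_sq (a := θs i) ?_
  filter_upwards [hcont.eventually hmin] with t ht
  simp only [sum_mul_sub_sq_update] at ht
  linarith
end

section
/- For all real numbers a and θ, one has (min a 0)^2 ≤ (a − θ^2)^2, with equality if and only if θ^2 = max a 0. -/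
/-- The quadratic slack penalty is bounded below by `(min a 0)^2`, with equality
exactly when `θ^2 = max a 0`. -/
theorem slack_penalty_lower_bound (a θ : ℝ) :
    (min a 0) ^ 2 ≤ (a - θ ^ 2) ^ 2 ∧
      ((min a 0) ^ 2 = (a - θ ^ 2) ^ 2 ↔ θ ^ 2 = max a 0) := by
  have ht : 0 ≤ θ ^ 2 := sq_nonneg θ
  generalize θ ^ 2 = t at ht ⊢
  rcases le_total a 0 with ha | ha
  · rw [min_eq_left ha, max_eq_right ha]
    refine ⟨by nlinarith, fun h => ?_, fun h => by rw [h, sub_zero]⟩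
    have h_prod : t * (t - 2 * a) = 0 := by linarith
    rcases mul_eq_zero.mp h_prod with h | h <;> linarith
  · rw [min_eq_right ha, max_eq_left ha]
    refine ⟨by nlinarith [sq_nonneg (a - t)], fun h => ?_, fun h => by simp [h]⟩
    have h_zero : a - t = 0 := pow_eq_zero_iff two_ne_zero |>.mp (by linarith)
    linarith
end

section
/- Let A be a symmetric real n × n matrix. If P, N and P', N' are two pairs of real n × n matrices such that P and P' are positive semidefinite, −N and −N' are positive semidefinite, A = P + N = P' + N', P * N = 0, and P' * N' = 0, then P = P' and N = N'. -/
open scoped MatrixOrder Matrix.Norms.L2Operator in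
lemma Matrix.posPart_negPart_eq_of_posSemidef {n : ℕ} {A P N : Matrix (Fin n) (Fin n) ℝ}
    (hP : P.PosSemidef) (hN : (-N).PosSemidef) (hsum : A = P + N) (hprod : P * N = 0) :
    A⁺ = P ∧ A⁻ = -N :=
  CFC.posPart_negPart_unique (by rw [hsum, sub_neg_eq_add]) (by rw [mul_neg, hprod, neg_zero])
    (Matrix.nonneg_iff_posSemidef.mpr hP) (Matrix.nonneg_iff_posSemidef.mpr hN)

/-- The decomposition of a symmetric real matrix into a positive semidefinite and a
negative semidefinite part with vanishing product is unique. -/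
theorem symm_matrix_posneg_split_unique {n : ℕ} (A : Matrix (Fin n) (Fin n) ℝ)
    (hA : A.IsSymm) (P N P' N' : Matrix (Fin n) (Fin n) ℝ)
    (hP : P.PosSemidef) (hP' : P'.PosSemidef)
    (hN : (-N).PosSemidef) (hN' : (-N').PosSemidef)
    (hsum : A = P + N) (hsum' : A = P' + N')
    (hprod : P * N = 0) (hprod' : P' * N' = 0) :
    P = P' ∧ N = N' := by
  have h := Matrix.posPart_negPart_eq_of_posSemidef hP hN hsum hprod
  have h' := Matrix.posPart_negPart_eq_of_posSemidef hP' hN' hsum' hprod'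
  exact ⟨h.1.symm.trans h'.1, neg_injective (h.2.symm.trans h'.2)⟩
end
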